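/- Let d ≥ 1, σ > 0, 0 < δ < 1, and let m, Δ ∈ ℝ^d. Let μ_m and μ_{m+Δ} be the product probability measures on ℝ^d whose i-th coordinates are Gaussian N(m_i, σ²) and N(m_i + Δ_i, σ²) respectively. Set ε = ‖Δ‖₂²/(2σ²) + ‖Δ‖₂·√(2·log(1/δ))/σ. Then for every measurable set S ⊆ ℝ^d, μ_m(S) ≤ e^ε · μ_{m+Δ}(S) + δ. -/

import Mathlib

open MeasureTheory ProbabilityTheory Real
open scoped ENNReal NNReal

/-- A product of probability measures with densities has the product density. -/
theorem pi_withDensity_eq_withDensity_prod {ι : Type*} [Fintype ι] {α : ι → Type*}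
    [∀ i, MeasurableSpace (α i)] (ν : ∀ i, Measure (α i)) [∀ i, IsProbabilityMeasure (ν i)]
    {f : ∀ i, α i → ℝ≥0∞} (hf : ∀ i, Measurable (f i))
    [∀ i, SigmaFinite ((ν i).withDensity (f i))] :
    Measure.pi (fun i => (ν i).withDensity (f i)) =
      (Measure.pi ν).withDensity (fun x => ∏ i, f i (x i)) := by
  refine Measure.pi_eq fun s hs => ?_
  rw [withDensity_apply _ (.univ_pi hs), ← lintegral_indicator (.univ_pi hs)]
  have hmeas (i) : Measurable ((s i).indicator (f i)) := (hf i).indicator (hs i)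
  have hprod : (Set.univ.pi s).indicator (fun x => ∏ i, f i (x i)) =
      fun x => ∏ i, (s i).indicator (f i) (x i) := by
    ext x
    by_cases hx : x ∈ Set.univ.pi s
    · rw [Set.indicator_of_mem hx]
      exact Finset.prod_congr rfl fun i _ => (Set.indicator_of_mem (hx i trivial) _).symm
    · rw [Set.indicator_of_notMem hx]
      obtain ⟨i, hi⟩ : ∃ i, x i ∉ s i := by simpa using hx
      exact (Finset.prod_eq_zero (Finset.mem_univ i) (Set.indicator_of_notMem hi _)).symm
  rw [hprod, lintegral_prod_eq_prod_lintegral_of_indepFun Finset.univ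
    (fun i (x : ∀ i, α i) => (s i).indicator (f i) (x i))
    (iIndepFun_pi fun i => (hmeas i).aemeasurable)
    (fun i => (hmeas i).comp (measurable_pi_apply i))]
  refine Finset.prod_congr rfl fun i _ => ?_
  rw [withDensity_apply _ (hs i), ← lintegral_indicator (hs i)]
  exact (measurePreserving_eval ν i).lintegral_comp (hmeas i)

/-- The likelihood ratio of two Gaussians with the same variance. -/
theorem gaussianReal_eq_withDensity_gaussianReal (a b : ℝ) {v : ℝ≥0} (hv : v ≠ 0) :
    gaussianReal a v = (gaussianReal b v).withDensity
      (fun x => ENNReal.ofReal (rexp (((x - b) ^ 2 - (x - a) ^ 2) / (2 * v)))) := by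
  rw [gaussianReal_of_var_ne_zero a hv, gaussianReal_of_var_ne_zero b hv,
    ← withDensity_mul _ (measurable_gaussianPDF b v) (by fun_prop)]
  congr 1
  ext x
  simp only [Pi.mul_apply, gaussianPDF]
  rw [← ENNReal.ofReal_mul (gaussianPDFReal_nonneg b v x), gaussianPDFReal, gaussianPDFReal,
    mul_assoc _ (rexp _), ← Real.exp_add]
  congr 3
  ring

theorem hasSubgaussianMGF_sub_mean_gaussianReal (a : ℝ) (v : ℝ≥0) :
    HasSubgaussianMGF (fun x => x - a) v (gaussianReal a v) := by
  have hmap : (gaussianReal a v).map (fun x => x - a) = gaussianReal 0 v := by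
    rw [gaussianReal_map_sub_const, sub_self]
  refine ⟨fun t => ?_, fun t => ?_⟩
  · have h := integrable_exp_mul_gaussianReal (μ := 0) (v := v) t
    rw [← hmap] at h
    exact h.comp_measurable (by fun_prop)
  · rw [mgf_gaussianReal hmap]
    simp

/-- Linear functionals of a spherical Gaussian vector have Gaussian upper tails. -/
theorem measure_pi_gaussianReal_ge_le {ι : Type*} [Fintype ι] (m c : ι → ℝ) (v : ℝ≥0)
    {r : ℝ} (hr : 0 ≤ r) :
    (Measure.pi fun i => gaussianReal (m i) v).real {x | r ≤ ∑ i, c i * (x i - m i)} ≤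
      rexp (-r ^ 2 / (2 * (v * ∑ i, c i ^ 2))) := by
  have hindep : iIndepFun (fun i (x : ι → ℝ) => c i * (x i - m i))
      (Measure.pi fun i => gaussianReal (m i) v) :=
    iIndepFun_pi (X := fun i y => c i * (y - m i)) fun i => by fun_prop
  have hsub (i) (_ : i ∈ Finset.univ) : HasSubgaussianMGF
      (fun x : ι → ℝ => c i * (x i - m i)) ((c i ^ 2).toNNReal * v)
      (Measure.pi fun i => gaussianReal (m i) v) := by
    refine HasSubgaussianMGF.of_map (Y := fun x : ι → ℝ => x i) (X := fun y => c i * (y - m i))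
      (measurable_pi_apply i).aemeasurable ?_
    rw [(measurePreserving_eval (fun i => gaussianReal (m i) v) i).map_eq,
      Real.toNNReal_of_nonneg (sq_nonneg (c i))]
    exact (hasSubgaussianMGF_sub_mean_gaussianReal (m i) v).const_mul (c i)
  have h := HasSubgaussianMGF.measure_sum_ge_le_of_iIndepFun hindep hsub hr
  convert h using 4
  simp [Finset.mul_sum, mul_comm, sq_nonneg]

/-- If a density is at most `c` outside a set of measure at most `δ`, then the two measures
are `(log c, δ)`-indistinguishable in one direction. -/
theorem withDensity_apply_le_mul_add {α : Type*} [MeasurableSpace α] {ν : Measure α}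
    {f : α → ℝ≥0∞} (hf : Measurable f) {c δ : ℝ≥0∞}
    (htail : ν.withDensity f {x | c < f x} ≤ δ) {S : Set α} (hS : MeasurableSet S) :
    ν.withDensity f S ≤ c * ν S + δ := by
  have hgood : MeasurableSet {x | f x ≤ c} := measurableSet_le hf measurable_const
  calc ν.withDensity f S
      ≤ ν.withDensity f (S ∩ {x | f x ≤ c} ∪ {x | c < f x}) :=
        measure_mono fun x hx => (le_or_gt (f x) c).imp (fun h => ⟨hx, h⟩) id
    _ ≤ ν.withDensity f (S ∩ {x | f x ≤ c}) + ν.withDensity f {x | c < f x} :=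
        measure_union_le _ _
    _ ≤ c * ν S + δ := by
        refine add_le_add ?_ htail
        rw [withDensity_apply _ (hS.inter hgood)]
        calc ∫⁻ x in S ∩ {x | f x ≤ c}, f x ∂ν
            ≤ ∫⁻ _ in S ∩ {x | f x ≤ c}, c ∂ν :=
              setLIntegral_mono measurable_const fun x hx => hx.2
          _ = c * ν (S ∩ {x | f x ≤ c}) := setLIntegral_const _ _
          _ ≤ c * ν S := by gcongr; exact Set.inter_subset_left

/-- (ε, δ)-pDP guarantee of the Gaussian mechanism: for the
spherical Gaussians with variance `σ²` centered at `m` and at `m + Δ`, and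
`ε = ‖Δ‖²/(2σ²) + ‖Δ‖√(2 log(1/δ))/σ`, every measurable `S` satisfies
`μ_m(S) ≤ e^ε μ_{m+Δ}(S) + δ`. -/
theorem statement7 (d : ℕ) (hd : 1 ≤ d) (σ : ℝ) (hσ : 0 < σ)
    (δ : ℝ) (hδ : 0 < δ) (hδ1 : δ < 1) (m Δ : Fin d → ℝ)
    (μm μmΔ : Measure (Fin d → ℝ))
    (hμm : μm = Measure.pi (fun i => gaussianReal (m i) ⟨σ ^ 2, sq_nonneg σ⟩))
    (hμmΔ : μmΔ = Measure.pi (fun i => gaussianReal (m i + Δ i) ⟨σ ^ 2, sq_nonneg σ⟩))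
    (ε : ℝ)
    (hε : ε = (∑ i, (Δ i) ^ 2) / (2 * σ ^ 2) +
        Real.sqrt (∑ i, (Δ i) ^ 2) * Real.sqrt (2 * Real.log (1 / δ)) / σ) :
    ∀ S : Set (Fin d → ℝ), MeasurableSet S →
      μm S ≤ ENNReal.ofReal (Real.exp ε) * μmΔ S + ENNReal.ofReal δ := by
  intro S hS
  set v : ℝ≥0 := ⟨σ ^ 2, sq_nonneg σ⟩
  have hv_coe : (v : ℝ) = σ ^ 2 := rfl
  have hv0 : v ≠ 0 := by
    rw [← NNReal.coe_ne_zero, hv_coe]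
    positivity
  set f : (Fin d → ℝ) → ℝ≥0∞ := fun x => ∏ i, ENNReal.ofReal
    (rexp (((x i - (m i + Δ i)) ^ 2 - (x i - m i) ^ 2) / (2 * v))) with hf
  have hdens : μm = μmΔ.withDensity f := by
    have h1 (i) := gaussianReal_eq_withDensity_gaussianReal (m i) (m i + Δ i) hv0
    have hσfin (i : Fin d) : SigmaFinite ((gaussianReal (m i + Δ i) v).withDensity fun x => ENNReal.ofReal
        (rexp (((x - (m i + Δ i)) ^ 2 - (x - m i) ^ 2) / (2 * v)))) := by
      rw [← h1 i]
      infer_instance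
    rw [hμm, hμmΔ, hf, ← pi_withDensity_eq_withDensity_prod
      (fun i => gaussianReal (m i + Δ i) v) (f := fun i y => ENNReal.ofReal
        (rexp (((y - (m i + Δ i)) ^ 2 - (y - m i) ^ 2) / (2 * v)))) (fun i => by fun_prop)]
    exact congrArg Measure.pi (funext h1)
  have hf_exp (x) : f x = ENNReal.ofReal (rexp ((∑ i, Δ i ^ 2) / (2 * σ ^ 2) +
      ∑ i, -(Δ i / σ ^ 2) * (x i - m i))) := by
    simp only [hf]
    rw [← ENNReal.ofReal_prod_of_nonneg fun i _ => (exp_pos _).le, ← Real.exp_sum,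
      Finset.sum_div, ← Finset.sum_add_distrib, hv_coe]
    congr 2
    refine Finset.sum_congr rfl fun i _ => ?_
    field_simp
    ring
  have hfm : Measurable f := by fun_prop
  set N := ∑ i, Δ i ^ 2 with hN
  have hN0 : 0 ≤ N := Finset.sum_nonneg fun i _ => sq_nonneg _
  set r := √N * √(2 * Real.log (1 / δ)) / σ with hr
  have hr0 : 0 ≤ r := by positivity
  have hlog : 0 ≤ 2 * Real.log (1 / δ) := by
    rw [one_div, Real.log_inv]
    linarith [Real.log_neg hδ hδ1]
  have htail : μm {x | ENNReal.ofReal (rexp ε) < f x} ≤ ENNReal.ofReal δ := by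
    have hset : {x | ENNReal.ofReal (rexp ε) < f x} =
        {x | r < ∑ i, -(Δ i / σ ^ 2) * (x i - m i)} := by
      ext x
      simp only [Set.mem_ofPred_eq]
      rw [hf_exp, ENNReal.ofReal_lt_ofReal_iff (exp_pos _), Real.exp_lt_exp, hε,
        add_lt_add_iff_left]
    rw [hset]
    rcases hN0.eq_or_lt with h0 | hpos
    · have hΔ (i) : Δ i = 0 := by
        have := (Finset.sum_eq_zero_iff_of_nonneg fun i _ => sq_nonneg (Δ i)).1 h0.symm i
          (Finset.mem_univ i)
        simpa using this
      simp [hΔ, hr0.not_gt]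
    · have hbound := measure_pi_gaussianReal_ge_le m (fun i => -(Δ i / σ ^ 2)) v hr0
      have hexp : -r ^ 2 / (2 * (v * ∑ i, (-(Δ i / σ ^ 2)) ^ 2)) = Real.log δ := by
        have hsum : ∑ i, (-(Δ i / σ ^ 2)) ^ 2 = N / σ ^ 4 := by
          rw [hN, Finset.sum_div]
          refine Finset.sum_congr rfl fun i _ => ?_
          ring
        rw [hsum, hr, div_pow, mul_pow, Real.sq_sqrt hN0, Real.sq_sqrt hlog, hv_coe, one_div,
          Real.log_inv]
        field_simp
      rw [hexp, Real.exp_log hδ, ← hμm] at hbound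
      have : IsProbabilityMeasure μm := by
        rw [hμm]
        infer_instance
      rw [← ofReal_measureReal]
      exact ENNReal.ofReal_le_ofReal
        ((measureReal_mono (Set.ofPred_subset_ofPred.2 fun x hx => le_of_lt hx)).trans hbound)
  rw [hdens] at htail ⊢
  exact withDensity_apply_le_mul_add hfm htail hS
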